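/- For any two additive codes C₁ and C₂ of dual type (α,β;γ₁,δ₁;κ₁) and (α,β;γ₂,δ₂;κ₂) respectively, the intersection number satisfies 2^(α+2β−μ) ≤ η(C₁,C₂) ≤ 2^(α+2β−max(κ₁+δ₁,κ₂+δ₂)−max(δ₁,δ₂)), where μ = min(γ₁+γ₂+2(δ₁+δ₂), γ₁+γ₂+δ₁+δ₂+β, δ₁+δ₂+α+β, α+2β). -/

import Mathlib

open scoped BigOperators

/-- `Z2` is the ring of integers modulo 2. -/
abbrev Z2 : Type := ZMod 2

/-- `Z4` is the ring of integers modulo 4. -/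
abbrev Z4 : Type := ZMod 4

/-- The ambient group `Z₂^α × Z₄^β` for additive codes. -/
abbrev Amb (α β : ℕ) : Type := (Fin α → Z2) × (Fin β → Z4)

/-- The inner product on `Z₂^α × Z₄^β`:
`⟨u,v⟩ = 2·(Σᵢ ūᵢ·v̄ᵢ) + Σⱼ uⱼ·vⱼ ∈ Z₄`, where the bar denotes the lift `0 ↦ 0`, `1 ↦ 1`
of binary coordinates into `Z₄`. -/
def addInner {α β : ℕ} (u v : Amb α β) : Z4 :=
  2 * (∑ i, ((u.1 i).val : Z4) * ((v.1 i).val : Z4)) + ∑ j, u.2 j * v.2 j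

lemma addInner_zero_left {α β : ℕ} (v : Amb α β) : addInner 0 v = 0 := by
  simp [addInner]

lemma addInner_add_left {α β : ℕ} (u u' v : Amb α β) :
    addInner (u + u') v = addInner u v + addInner u' v := by
  have key : ∀ x x' y : Z2,
      (2 : Z4) * ((((x + x').val : ℕ) : Z4) * ((y.val : ℕ) : Z4)) =
        2 * (((x.val : ℕ) : Z4) * ((y.val : ℕ) : Z4)) +
          2 * (((x'.val : ℕ) : Z4) * ((y.val : ℕ) : Z4)) := by decide
  simp only [addInner, Prod.fst_add, Prod.snd_add, Pi.add_apply, add_mul,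
    Finset.mul_sum, Finset.sum_add_distrib]
  rw [Finset.sum_congr rfl (fun i _ => key (u.1 i) (u'.1 i) (v.1 i)),
    Finset.sum_add_distrib]
  ring

lemma addInner_neg_left {α β : ℕ} (u v : Amb α β) :
    addInner (-u) v = - addInner u v := by
  have hn : ∀ x : Z2, (-x) = x := by decide
  have key : ∀ S T : Z4, 2 * S + -T = -(2 * S + T) := by decide
  simp only [addInner, Prod.fst_neg, Prod.snd_neg, Pi.neg_apply, hn, neg_mul]
  rw [Finset.sum_neg_distrib]
  exact key _ _

/-- The additive dual `C^⊥ = {u : ⟨u,v⟩ = 0 for all v ∈ C}` of an additive code `C`. -/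
def dualCode {α β : ℕ} (C : AddSubgroup (Amb α β)) : AddSubgroup (Amb α β) where
  carrier := {u | ∀ v ∈ C, addInner u v = 0}
  zero_mem' := fun v _ => addInner_zero_left v
  add_mem' := by
    intro a b ha hb v hv
    rw [addInner_add_left, ha v hv, hb v hv, add_zero]
  neg_mem' := by
    intro a ha v hv
    rw [addInner_neg_left, ha v hv, neg_zero]

/-- An additive code `C ⊆ Z₂^α × Z₄^β` is of type `(α,β;γ,δ)` when it is isomorphic,
as an abelian group, to `Z₂^γ × Z₄^δ`; equivalently (which is how we state it),
`|C| = 2^(γ+2δ)` and the number of elements `x ∈ C` with `x + x = 0` is `2^(γ+δ)`. -/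
def isOfType {α β : ℕ} (C : AddSubgroup (Amb α β)) (γ δ : ℕ) : Prop :=
  Nat.card C = 2 ^ (γ + 2 * δ) ∧
    Nat.card {x : Amb α β // x ∈ C ∧ x + x = 0} = 2 ^ (γ + δ)

/-- An additive code `C` is of type `(α,β;γ,δ;κ)` when it is of type `(α,β;γ,δ)` and
`2^κ` is the cardinality of the image of `{x ∈ C : x + x = 0}` under the projection
onto the binary coordinates. -/
def isOfTypeK {α β : ℕ} (C : AddSubgroup (Amb α β)) (γ δ κ : ℕ) : Prop :=
  isOfType C γ δ ∧
    Nat.card ↥(Prod.fst '' {x : Amb α β | x ∈ C ∧ x + x = 0}) = 2 ^ κ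

/-- The Gray map on one quaternary coordinate:
`0 ↦ (0,0)`, `1 ↦ (0,1)`, `2 ↦ (1,1)`, `3 ↦ (1,0)`. -/
def grayPhi (y : Z4) : Z2 × Z2 :=
  if y = 0 then (0, 0) else if y = 1 then (0, 1) else if y = 2 then (1, 1) else (1, 0)

/-- The Gray map `Φ : Z₂^α × Z₄^β → Z₂^(α+2β)` (with index set `Fin α ⊕ Fin β × Fin 2`),
acting as the identity on the binary coordinates and as `grayPhi` coordinatewise on the
quaternary coordinates. -/
def grayMap {α β : ℕ} (u : Amb α β) : (Fin α ⊕ Fin β × Fin 2) → Z2 :=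
  Sum.elim (fun a => u.1 a)
    (fun b => if b.2 = 0 then (grayPhi (u.2 b.1)).1 else (grayPhi (u.2 b.1)).2)

/-- The minimum Hamming distance of a binary code `S` equals `d`. -/
def minDistEq {ι : Type} [Fintype ι] (S : Set (ι → Z2)) (d : ℕ) : Prop :=
  (∀ x ∈ S, ∀ y ∈ S, x ≠ y → d ≤ hammingDist x y) ∧
    ∃ x ∈ S, ∃ y ∈ S, x ≠ y ∧ hammingDist x y = d

/-- A quaternary linear perfect code of length `β = 2^(t-1)` (`t ≥ 3`): an additive
subgroup of `Z₄^β` whose Gray image has cardinality `2^(2β-t-1)` and minimum Hamming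
distance `4`. -/
def isQuatPerfect (t β : ℕ) (C : AddSubgroup (Amb 0 β)) : Prop :=
  3 ≤ t ∧ β = 2 ^ (t - 1) ∧
    Nat.card ↥(grayMap '' (C : Set (Amb 0 β))) = 2 ^ (2 * β - t - 1) ∧
    minDistEq (grayMap '' (C : Set (Amb 0 β))) 4

/-- An additive extended perfect code with `α ≠ 0` and binary length `α + 2β = 2^t`:
an additive subgroup of `Z₂^α × Z₄^β` with `α ≥ 1` whose Gray image has cardinality
`2^(2^t - t - 1)` and minimum Hamming distance `4`. -/
def isAddExtPerfect (t α β : ℕ) (C : AddSubgroup (Amb α β)) : Prop :=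
  1 ≤ α ∧ α + 2 * β = 2 ^ t ∧
    Nat.card ↥(grayMap '' (C : Set (Amb α β))) = 2 ^ (2 ^ t - t - 1) ∧
    minDistEq (grayMap '' (C : Set (Amb α β))) 4

/-- The doubling endomorphism. -/
def doubling (G : Type*) [AddCommGroup G] : G →+ G := nsmulAddMonoidHom 2

lemma doubling_apply {G : Type*} [AddCommGroup G] (x : G) : doubling G x = x + x :=
  two_nsmul x

lemma mem_ker_doubling {G : Type*} [AddCommGroup G] (x : G) :
    x ∈ (doubling G).ker ↔ x + x = 0 := by
  rw [AddMonoidHom.mem_ker, doubling_apply]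

lemma card_map_mul_card_inf_ker {G G' : Type*} [AddCommGroup G] [AddCommGroup G']
    (f : G →+ G') (H : AddSubgroup G) :
    Nat.card (H.map f) * Nat.card (H ⊓ f.ker : AddSubgroup G) = Nat.card H := by
  have e := (AddSubgroup.card_eq_card_quotient_mul_card_addSubgroup (f.comp H.subtype).ker).symm
  rw [Nat.card_congr (QuotientAddGroup.quotientKerEquivRange (f.comp H.subtype)).toEquiv] at e
  have hr : (f.comp H.subtype).range = H.map f := by
    rw [AddMonoidHom.range_comp, AddSubgroup.range_subtype]
  have hk : (f.comp H.subtype).ker = (H ⊓ f.ker).addSubgroupOf H := by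
    ext x
    simp [AddSubgroup.mem_addSubgroupOf, AddMonoidHom.mem_ker]
  rw [hr, hk, Nat.card_congr (AddSubgroup.addSubgroupOfEquivOfLe inf_le_left).toEquiv] at e
  exact e

lemma card_map_mul_card_le {G G' : Type*} [AddCommGroup G] [AddCommGroup G'] [Finite G]
    (f : G →+ G') {H P : AddSubgroup G} (hHP : H ≤ P) :
    Nat.card (P.map f) * Nat.card H ≤ Nat.card P * Nat.card (H.map f) := by
  rw [← card_map_mul_card_inf_ker f H, ← card_map_mul_card_inf_ker f P]
  have h : Nat.card (H ⊓ f.ker : AddSubgroup G) ≤ Nat.card (P ⊓ f.ker : AddSubgroup G) :=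
    AddSubgroup.card_le_of_le (inf_le_inf_right _ hHP)
  calc _ = Nat.card (P.map f) * Nat.card (H.map f) * Nat.card (H ⊓ f.ker : AddSubgroup G) := by
        ring
    _ ≤ Nat.card (P.map f) * Nat.card (H.map f) * Nat.card (P ⊓ f.ker : AddSubgroup G) :=
        Nat.mul_le_mul_left _ h
    _ = _ := by ring

lemma card_prod_addSubgroup {G G' : Type*} [AddCommGroup G] [AddCommGroup G']
    (A : AddSubgroup G) (B : AddSubgroup G') :
    Nat.card (A.prod B) = Nat.card A * Nat.card B := by
  rw [Nat.card_congr (AddSubgroup.prodEquiv A B).toEquiv, Nat.card_prod]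

lemma map_coprod_prod {G : Type*} [AddCommGroup G] (A B : AddSubgroup G) :
    (A.prod B).map ((AddMonoidHom.id G).coprod (AddMonoidHom.id G)) = A ⊔ B := by
  ext x
  simp [AddSubgroup.mem_map, AddSubgroup.mem_prod, AddSubgroup.mem_sup, and_assoc]

lemma card_sup_mul_le {G : Type*} [AddCommGroup G] [Finite G] {A A' B B' : AddSubgroup G}
    (hA : A' ≤ A) (hB : B' ≤ B) :
    Nat.card (A ⊔ B : AddSubgroup G) * (Nat.card A' * Nat.card B') ≤
      Nat.card A * Nat.card B * Nat.card (A' ⊔ B' : AddSubgroup G) := by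
  have h := card_map_mul_card_le ((AddMonoidHom.id G).coprod (AddMonoidHom.id G))
    (AddSubgroup.prod_mono hA hB)
  simpa only [map_coprod_prod, card_prod_addSubgroup] using h

lemma card_sup_le {G : Type*} [AddCommGroup G] [Finite G] (A B : AddSubgroup G) :
    Nat.card (A ⊔ B : AddSubgroup G) ≤ Nat.card A * Nat.card B := by
  simpa using card_sup_mul_le (bot_le : ⊥ ≤ A) (bot_le : ⊥ ≤ B)

lemma card_amb (α β : ℕ) : Nat.card (Amb α β) = 2 ^ (α + 2 * β) := by
  simp [Nat.card_eq_fintype_card, ZMod.card, pow_add, pow_mul]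

/-- The embedding of binary vectors as the elements of order at most two. -/
def doubleLift {α β : ℕ} (p : (Fin α → Z2) × (Fin β → Z2)) : Amb α β :=
  (p.1, fun j => 2 * ((p.2 j).val : Z4))

lemma exists_two_mul_val : ∀ x : Z4, ∃ y : Z2, 2 * ((y.val : ℕ) : Z4) = x + x := by decide

lemma exists_two_mul_val_of_add_self :
    ∀ x : Z4, x + x = 0 → ∃ y : Z2, 2 * ((y.val : ℕ) : Z4) = x := by decide

lemma card_map_doubling_le {α β : ℕ} (H : AddSubgroup (Amb α β)) :
    Nat.card (H.map (doubling _)) ≤ 2 ^ β := by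
  have hsub : ((H.map (doubling _) : AddSubgroup (Amb α β)) : Set (Amb α β)) ⊆
      Set.range fun v : Fin β → Z2 => doubleLift (0, v) := by
    rintro _ ⟨x, -, rfl⟩
    choose y hy using fun j => exists_two_mul_val (x.2 j)
    refine ⟨y, Prod.ext ?_ ?_⟩
    · funext i
      have h : ∀ z : Z2, 0 = z + z := by decide
      rw [doubling_apply]
      exact h (x.1 i)
    · funext j
      rw [doubling_apply]
      exact hy j
  calc Nat.card (H.map (doubling _)) ≤ _ := Nat.card_mono (Set.toFinite _) hsub
    _ ≤ Nat.card (Fin β → Z2) := Finite.card_range_le _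
    _ = 2 ^ β := by simp [Nat.card_eq_fintype_card, ZMod.card]

lemma card_inf_ker_doubling_le {α β : ℕ} (H : AddSubgroup (Amb α β)) :
    Nat.card (H ⊓ (doubling _).ker : AddSubgroup (Amb α β)) ≤ 2 ^ (α + β) := by
  have hsub : ((H ⊓ (doubling _).ker : AddSubgroup (Amb α β)) : Set (Amb α β)) ⊆
      Set.range doubleLift := by
    rintro x ⟨-, hx⟩
    have hx := (mem_ker_doubling x).1 hx
    choose y hy using fun j => exists_two_mul_val_of_add_self (x.2 j)
      (by simpa using congrFun (congrArg Prod.snd hx) j)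
    exact ⟨(x.1, y), Prod.ext rfl (funext hy)⟩
  calc Nat.card (H ⊓ (doubling _).ker : AddSubgroup (Amb α β)) ≤ _ :=
        Nat.card_mono (Set.toFinite _) hsub
    _ ≤ Nat.card ((Fin α → Z2) × (Fin β → Z2)) := Finite.card_range_le _
    _ = 2 ^ (α + β) := by simp [Nat.card_eq_fintype_card, ZMod.card, pow_add]

lemma addInner_comm {α β : ℕ} (u v : Amb α β) : addInner u v = addInner v u := by
  simp [addInner, mul_comm]

lemma addInner_add_right {α β : ℕ} (u v v' : Amb α β) :
    addInner u (v + v') = addInner u v + addInner u v' := by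
  simp only [addInner_comm u, addInner_add_left]

lemma eq_zero_of_forall_addInner {α β : ℕ} {v : Amb α β} (h : ∀ u, addInner u v = 0) :
    v = 0 := by
  refine Prod.ext ?_ ?_
  · funext i
    have hi := h (Pi.single i 1, 0)
    have key : ∀ x : Z2, 2 * ((x.val : ℕ) : Z4) = 0 → x = 0 := by decide
    apply key
    rw [addInner, Finset.sum_eq_single i] at hi
    · simpa [ZMod.val_one] using hi
    · intro j _ hj
      simp [Pi.single_eq_of_ne hj]
    · simp
  · funext j
    simpa [addInner, Pi.single_apply] using h (0, Pi.single j 1)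

/-- The additive character `v ↦ ψ ⟨u, v⟩` for the standard character `ψ` of `Z₄`. -/
noncomputable def innerChar {α β : ℕ} (u : Amb α β) : AddChar (Amb α β) ℂ where
  toFun v := ZMod.stdAddChar (addInner u v)
  map_zero_eq_one' := by simp [addInner_comm u, addInner_zero_left]
  map_add_eq_mul' v v' := by rw [addInner_add_right, AddChar.map_add_eq_mul]

lemma innerChar_apply_eq_one {α β : ℕ} {u v : Amb α β} :
    innerChar u v = 1 ↔ addInner u v = 0 := by
  rw [← (ZMod.stdAddChar (N := 4)).map_zero_eq_one]
  exact ZMod.injective_stdAddChar.eq_iff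

lemma card_mul_card_dualCode {α β : ℕ} (C : AddSubgroup (Amb α β)) :
    Nat.card C * Nat.card (dualCode C) = 2 ^ (α + 2 * β) := by
  classical
  have hrow (u : Amb α β) : ∑ c : C, innerChar u c =
      if u ∈ dualCode C then (Nat.card C : ℂ) else 0 := by
    have h := AddChar.sum_eq_ite ((innerChar u).compAddMonoidHom C.subtype)
    have hiff : (innerChar u).compAddMonoidHom C.subtype = 0 ↔ u ∈ dualCode C := by
      rw [DFunLike.ext_iff]
      simp only [AddChar.compAddMonoidHom_apply, AddChar.zero_apply, innerChar_apply_eq_one,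
        Subtype.forall]
      rfl
    simpa [hiff, Nat.card_eq_fintype_card] using h
  have hcol (c : C) : ∑ u : Amb α β, innerChar u c =
      if c = 0 then (Nat.card (Amb α β) : ℂ) else 0 := by
    have h := AddChar.sum_eq_ite (innerChar (c : Amb α β))
    have hiff : innerChar (c : Amb α β) = 0 ↔ c = 0 := by
      rw [DFunLike.ext_iff]
      simp only [AddChar.zero_apply, innerChar_apply_eq_one]
      constructor
      · intro h
        exact Subtype.ext (eq_zero_of_forall_addInner fun u => (addInner_comm _ _).trans (h u))
      · rintro rfl v
        exact addInner_zero_left v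
    have hs : ∀ u : Amb α β, innerChar u c = innerChar (c : Amb α β) u := fun u =>
      congrArg ZMod.stdAddChar (addInner_comm _ _)
    simp only [hs, h, hiff, Nat.card_eq_fintype_card]
  have hsum := Finset.sum_comm (s := Finset.univ) (t := Finset.univ)
    (f := fun (u : Amb α β) (c : C) => innerChar u c)
  simp only [hrow, hcol] at hsum
  rw [Finset.sum_ite_eq' Finset.univ (0 : C), ← Finset.sum_filter, Finset.sum_const] at hsum
  rw [← card_amb]
  have hd : Nat.card (dualCode C) = (Finset.univ.filter (· ∈ dualCode C)).card := by
    rw [Nat.card_eq_fintype_card, Fintype.card_subtype]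
  rw [hd, mul_comm]
  simp only [Finset.mem_univ, if_true, nsmul_eq_mul] at hsum
  exact_mod_cast hsum

lemma dualCode_dualCode {α β : ℕ} (C : AddSubgroup (Amb α β)) :
    dualCode (dualCode C) = C := by
  refine (AddSubgroup.eq_of_le_of_card_ge (fun v hv u hu => ?_) ?_).symm
  · rw [addInner_comm]
    exact hu v hv
  · have h₁ := card_mul_card_dualCode C
    have h₂ := card_mul_card_dualCode (dualCode C)
    rw [mul_comm, ← h₂] at h₁
    exact (Nat.eq_of_mul_eq_mul_left Nat.card_pos h₁).ge

lemma dualCode_sup {α β : ℕ} (C D : AddSubgroup (Amb α β)) :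
    dualCode (C ⊔ D) = dualCode C ⊓ dualCode D := by
  ext u
  constructor
  · exact fun h => ⟨fun v hv => h v (AddSubgroup.mem_sup_left hv),
      fun v hv => h v (AddSubgroup.mem_sup_right hv)⟩
  · rintro ⟨hC, hD⟩ v hv
    obtain ⟨c, hc, d, hd, rfl⟩ := AddSubgroup.mem_sup.1 hv
    rw [addInner_add_right, hC c hc, hD d hd, add_zero]

lemma isOfType.card_inf_ker {α β γ δ : ℕ} {D : AddSubgroup (Amb α β)} (h : isOfType D γ δ) :
    Nat.card (D ⊓ (doubling _).ker : AddSubgroup (Amb α β)) = 2 ^ (γ + δ) := by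
  rw [← h.2]
  exact Nat.card_congr (Equiv.subtypeEquivRight fun x => by
    rw [AddSubgroup.mem_inf, mem_ker_doubling])

lemma isOfType.card_map_doubling {α β γ δ : ℕ} {D : AddSubgroup (Amb α β)}
    (h : isOfType D γ δ) : Nat.card (D.map (doubling _)) = 2 ^ δ := by
  have e := card_map_mul_card_inf_ker (doubling _) D
  rw [h.card_inf_ker, h.1, show γ + 2 * δ = δ + (γ + δ) by ring, pow_add 2 δ] at e
  exact Nat.eq_of_mul_eq_mul_right (by positivity) e

lemma isOfTypeK.kappa_le_gamma {α β γ δ κ : ℕ} {D : AddSubgroup (Amb α β)} (h : isOfTypeK D γ δ κ) :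
    κ ≤ γ := by
  have e := card_map_mul_card_inf_ker (AddMonoidHom.fst (Fin α → Z2) (Fin β → Z4))
    (D ⊓ (doubling _).ker)
  have himg : Nat.card ((D ⊓ (doubling _).ker).map
      (AddMonoidHom.fst (Fin α → Z2) (Fin β → Z4))) = 2 ^ κ := by
    rw [← h.2]
    refine Nat.card_congr (Equiv.setCongr ?_)
    ext x
    simp only [AddSubgroup.coe_map, Set.mem_image, SetLike.mem_coe, AddSubgroup.mem_inf,
      mem_ker_doubling, Set.mem_ofPred_eq, AddMonoidHom.coe_fst]
  have hle : D.map (doubling _) ≤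
      D ⊓ (doubling _).ker ⊓ (AddMonoidHom.fst (Fin α → Z2) (Fin β → Z4)).ker := by
    rintro _ ⟨x, hx, rfl⟩
    have h2 : ∀ z : Z2, z + z = 0 := by decide
    have h4 : ∀ z : Z4, z + z + (z + z) = 0 := by decide
    refine ⟨⟨D.nsmul_mem hx 2, (mem_ker_doubling _).2 ?_⟩, ?_⟩ <;> rw [doubling_apply]
    · refine Prod.ext (funext fun i => ?_) (funext fun j => ?_)
      · exact h2 _
      · exact h4 (x.2 j)
    · exact funext fun i => h2 (x.1 i)
  have hcard := AddSubgroup.card_le_of_le hle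
  rw [h.1.card_map_doubling] at hcard
  rw [himg, h.1.card_inf_ker] at e
  have hpow : 2 ^ (κ + δ) ≤ 2 ^ (γ + δ) := by
    rw [← e, pow_add]
    exact Nat.mul_le_mul_left _ hcard
  exact Nat.le_of_add_le_add_right ((Nat.pow_le_pow_iff_right one_lt_two).1 hpow)

lemma pow_le_card_inf_ker_doubling {α β γ δ κ : ℕ} {D S : AddSubgroup (Amb α β)}
    (h : isOfTypeK D γ δ κ) (hDS : D ≤ S) :
    2 ^ (κ + δ) ≤ Nat.card (S ⊓ (doubling _).ker : AddSubgroup (Amb α β)) :=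
  calc 2 ^ (κ + δ) ≤ 2 ^ (γ + δ) :=
        Nat.pow_le_pow_right two_pos (Nat.add_le_add_right h.kappa_le_gamma δ)
    _ = Nat.card (D ⊓ (doubling _).ker : AddSubgroup (Amb α β)) := h.1.card_inf_ker.symm
    _ ≤ _ := AddSubgroup.card_le_of_le (inf_le_inf_right _ hDS)

lemma pow_le_card_map_doubling {α β γ δ : ℕ} {D S : AddSubgroup (Amb α β)}
    (h : isOfType D γ δ) (hDS : D ≤ S) : 2 ^ δ ≤ Nat.card (S.map (doubling _)) := by
  rw [← h.card_map_doubling]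
  exact AddSubgroup.card_le_of_le (AddSubgroup.map_mono hDS)

lemma map_doubling_le {α β : ℕ} (D : AddSubgroup (Amb α β)) :
    D.map (doubling _) ≤ D := by
  rintro _ ⟨x, hx, rfl⟩
  exact D.nsmul_mem hx 2

lemma card_sup_le_pow {α β γ₁ δ₁ γ₂ δ₂ : ℕ} {D₁ D₂ : AddSubgroup (Amb α β)}
    (h₁ : isOfType D₁ γ₁ δ₁) (h₂ : isOfType D₂ γ₂ δ₂) :
    Nat.card (D₁ ⊔ D₂ : AddSubgroup (Amb α β)) ≤
      2 ^ (min (min (γ₁ + γ₂ + 2 * (δ₁ + δ₂)) (γ₁ + γ₂ + δ₁ + δ₂ + β))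
        (min (δ₁ + δ₂ + α + β) (α + 2 * β))) := by
  have hS := card_map_mul_card_inf_ker (doubling _) (D₁ ⊔ D₂)
  have hmap : (D₁ ⊔ D₂).map (doubling _) = D₁.map (doubling _) ⊔ D₂.map (doubling _) :=
    AddSubgroup.map_sup _ _ _
  have hmapδ : Nat.card ((D₁ ⊔ D₂).map (doubling _)) ≤ 2 ^ (δ₁ + δ₂) := by
    rw [hmap, pow_add, ← h₁.card_map_doubling, ← h₂.card_map_doubling]
    exact card_sup_le _ _
  rcases min_choice (min (γ₁ + γ₂ + 2 * (δ₁ + δ₂)) (γ₁ + γ₂ + δ₁ + δ₂ + β))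
    (min (δ₁ + δ₂ + α + β) (α + 2 * β)) with h | h <;> rw [h]
  · rcases min_choice (γ₁ + γ₂ + 2 * (δ₁ + δ₂)) (γ₁ + γ₂ + δ₁ + δ₂ + β) with h | h <;> rw [h]
    · refine (card_sup_le D₁ D₂).trans_eq ?_
      rw [h₁.1, h₂.1]
      ring
    · have hd := card_sup_mul_le (map_doubling_le D₁) (map_doubling_le D₂)
      rw [← hmap, h₁.card_map_doubling, h₂.card_map_doubling, h₁.1, h₂.1] at hd
      refine Nat.le_of_mul_le_mul_right (c := 2 ^ δ₁ * 2 ^ δ₂) ?_ (by positivity)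
      refine (hd.trans (Nat.mul_le_mul_left _ (card_map_doubling_le _))).trans_eq ?_
      ring
  · rcases min_choice (δ₁ + δ₂ + α + β) (α + 2 * β) with h | h <;> rw [h]
    · rw [← hS, add_assoc, pow_add]
      exact Nat.mul_le_mul hmapδ (card_inf_ker_doubling_le _)
    · rw [← card_amb]
      exact AddSubgroup.card_le_card_addGroup _

lemma pow_le_card_sup {α β γ₁ δ₁ κ₁ γ₂ δ₂ κ₂ : ℕ} {D₁ D₂ : AddSubgroup (Amb α β)}
    (h₁ : isOfTypeK D₁ γ₁ δ₁ κ₁) (h₂ : isOfTypeK D₂ γ₂ δ₂ κ₂) :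
    2 ^ (max (κ₁ + δ₁) (κ₂ + δ₂) + max δ₁ δ₂) ≤
      Nat.card (D₁ ⊔ D₂ : AddSubgroup (Amb α β)) := by
  rw [← card_map_mul_card_inf_ker (doubling _) (D₁ ⊔ D₂), pow_add, mul_comm]
  refine Nat.mul_le_mul ?_ ?_
  · rcases max_choice δ₁ δ₂ with h | h <;> rw [h]
    · exact pow_le_card_map_doubling h₁.1 le_sup_left
    · exact pow_le_card_map_doubling h₂.1 le_sup_right
  · rcases max_choice (κ₁ + δ₁) (κ₂ + δ₂) with h | h <;> rw [h]
    · exact pow_le_card_inf_ker_doubling h₁ le_sup_left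
    · exact pow_le_card_inf_ker_doubling h₂ le_sup_right

/-- bounds on the intersection number of two additive codes of given
dual types. -/
theorem stmt4 {α β γ₁ δ₁ κ₁ γ₂ δ₂ κ₂ : ℕ} (C₁ C₂ : AddSubgroup (Amb α β))
    (h₁ : isOfTypeK (dualCode C₁) γ₁ δ₁ κ₁) (h₂ : isOfTypeK (dualCode C₂) γ₂ δ₂ κ₂) :
    2 ^ (α + 2 * β - min (min (γ₁ + γ₂ + 2 * (δ₁ + δ₂)) (γ₁ + γ₂ + δ₁ + δ₂ + β))
        (min (δ₁ + δ₂ + α + β) (α + 2 * β))) ≤ Nat.card ↥(C₁ ⊓ C₂) ∧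
      Nat.card ↥(C₁ ⊓ C₂) ≤
        2 ^ (α + 2 * β - max (κ₁ + δ₁) (κ₂ + δ₂) - max δ₁ δ₂) := by
  have hC : C₁ ⊓ C₂ = dualCode (dualCode C₁ ⊔ dualCode C₂) := by
    rw [dualCode_sup, dualCode_dualCode, dualCode_dualCode]
  have hprod := card_mul_card_dualCode (dualCode C₁ ⊔ dualCode C₂)
  rw [← hC] at hprod
  have hpos : 0 < Nat.card ↥(C₁ ⊓ C₂) := Nat.card_pos
  constructor
  · refine Nat.le_of_mul_le_mul_right ?_ (Nat.two_pow_pos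
      (min (min (γ₁ + γ₂ + 2 * (δ₁ + δ₂)) (γ₁ + γ₂ + δ₁ + δ₂ + β))
        (min (δ₁ + δ₂ + α + β) (α + 2 * β))))
    rw [← pow_add, Nat.sub_add_cancel ((min_le_right _ _).trans (min_le_right _ _)), ← hprod,
      mul_comm]
    exact Nat.mul_le_mul_left _ (card_sup_le_pow h₁.1 h₂.1)
  · have hle := pow_le_card_sup h₁ h₂
    have hexp : max (κ₁ + δ₁) (κ₂ + δ₂) + max δ₁ δ₂ ≤ α + 2 * β := by
      refine (Nat.pow_le_pow_iff_right one_lt_two).1 (hle.trans ?_)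
      rw [← hprod]
      exact Nat.le_mul_of_pos_right _ hpos
    rw [Nat.sub_sub]
    refine Nat.le_of_mul_le_mul_right ?_ (Nat.two_pow_pos
      (max (κ₁ + δ₁) (κ₂ + δ₂) + max δ₁ δ₂))
    rw [← pow_add, Nat.sub_add_cancel hexp, ← hprod, mul_comm]
    exact Nat.mul_le_mul_right _ hle
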